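/- arXiv:2011.05952 — 2 statements merged into one kernel-verified Lean document; each statement's English description precedes it below -/
import Mathlib

section
/- Let q be an even positive integer, a an integer with gcd(a,q)=1, and n an even integer. If q ≡ 2 (mod 4), then G(a,n;q) = 0. If q ≡ 0 (mod 4), then G(a,n;q) = e(−ā·(n/2)²/q)·G(a;q), where ā is any integer with ā·a ≡ 1 (mod q). -/
open Complex Real MeasureTheory Filter Finset

noncomputable section

/-- The nontrivial Dirichlet character mod 4, extended to `ℤ`, valued in `ℂ`. -/
def chi4 (m : ℤ) : ℂ := if m % 4 = 1 then 1 else if m % 4 = 3 then -1 else 0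

/-- `σ_s(χ₄; n) = ∑_{d ∣ n} χ₄(d) d^s`. -/
def sigmaChi4 (s : ℂ) (n : ℕ) : ℂ := ∑ d ∈ n.divisors, chi4 d * (d : ℂ) ^ s

/-- `σ'_s(χ₄; n) = ∑_{d ∣ n} χ₄(d) d^s log d`. -/
def sigmaChi4' (s : ℂ) (n : ℕ) : ℂ := ∑ d ∈ n.divisors, chi4 d * (d : ℂ) ^ s * (Real.log d : ℂ)

/-- `e(x) = exp(2πix)`. -/
def e2pi (x : ℂ) : ℂ := Complex.exp (2 * (Real.pi : ℂ) * Complex.I * x)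

/-- The Dirichlet L-function of the nontrivial character mod 4. -/
def Lchi4 (s : ℂ) : ℂ :=
  DirichletCharacter.LFunction (ZMod.χ₄.ringHomComp (Int.castRingHom ℂ)) s

/-- Generalized quadratic Gauss sum `G(a, n; q)`. -/
def Gsum (a n : ℤ) (q : ℕ) : ℂ :=
  ∑ x ∈ Finset.range q, e2pi (((a * (x : ℤ) ^ 2 + n * (x : ℤ) : ℤ) : ℂ) / (q : ℂ))

/-- `K(n, l; q) = ∑_{a b ≡ 1 (mod q)} G(a,n;q) G(b,l;q)`. -/
def Ksum (n l : ℤ) (q : ℕ) : ℂ :=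
  ∑ a ∈ Finset.range q, ∑ b ∈ Finset.range q,
    if (a * b) % q = 1 % q then Gsum a n q * Gsum b l q else 0

/-- Kloosterman sum `S(m, n; c)`. -/
def kloosterman (m n : ℤ) (c : ℕ) : ℂ :=
  ∑ x ∈ Finset.range c,
    if Nat.gcd x c = 1 then
      e2pi (((m * (x : ℤ) + n * ((((x : ZMod c)⁻¹).val : ℕ) : ℤ) : ℤ) : ℂ) / (c : ℂ))
    else 0

/-- Ramanujan sum `c_C(m)`. -/
def ramanujanSum (C : ℕ) (m : ℤ) : ℂ :=
  ∑ D ∈ Finset.range C,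
    if Nat.gcd D C = 1 then e2pi (((m * (D : ℤ) : ℤ) : ℂ) / (C : ℂ)) else 0

/-- Gauss sum `g(χ₄; q; m)`. -/
def gaussChi4 (q : ℕ) (m : ℤ) : ℂ :=
  ∑ u ∈ Finset.range q,
    if Nat.gcd u q = 1 then chi4 u * e2pi (((m * (u : ℤ) : ℤ) : ℂ) / (q : ℂ)) else 0

end

lemma e2pi_std (q : ℕ) [NeZero q] (k : ℤ) :
    e2pi ((k : ℂ) / (q : ℂ)) = ZMod.stdAddChar (N := q) (k : ZMod q) := by
  rw [ZMod.stdAddChar_coe, e2pi]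
  congr 1
  ring

lemma Gsum_zmod (a n : ℤ) (q : ℕ) [NeZero q] :
    Gsum a n q = ∑ x : ZMod q, ZMod.stdAddChar (N := q) (a * x ^ 2 + n * x) := by
  unfold Gsum
  refine Finset.sum_bij' (fun x _ => (x : ZMod q)) (fun x _ => x.val) ?_ ?_ ?_ ?_ ?_
  · intro x _; exact Finset.mem_univ _
  · intro x _; exact Finset.mem_range.2 (ZMod.val_lt x)
  · intro x hx; exact ZMod.val_cast_of_lt (Finset.mem_range.1 hx)
  · intro x _; exact ZMod.natCast_zmod_val x
  · intro x _
    rw [e2pi_std]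
    push_cast
    rfl

/-- `G(a,n;q)` for `q` even and `n` even. -/
theorem Gsum_even_n_even_q (q : ℕ) (hq : 0 < q) (hqe : Even q) (a : ℤ)
    (ha : Int.gcd a q = 1) (n : ℤ) (hn : Even n) :
    (q % 4 = 2 → Gsum a n q = 0) ∧
    (q % 4 = 0 → ∀ abar : ℤ, abar * a ≡ 1 [ZMOD (q : ℤ)] →
      Gsum a n q = e2pi (((-(abar * (n / 2) ^ 2) : ℤ) : ℂ) / (q : ℂ)) * Gsum a 0 q) := by
  haveI : NeZero q := ⟨hq.ne'⟩
  obtain ⟨m, rfl⟩ := hn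
  constructor
  · intro h4
    obtain ⟨h, hh⟩ := hqe
    have hodd : Odd (h : ℤ) := by
      rw [Int.odd_iff]; omega
    have haodd : Odd a := by
      rw [← Int.not_even_iff_odd]
      intro hae
      have h1 : (2 : ℤ) ∣ Int.gcd a q := Int.dvd_coe_gcd hae.two_dvd ⟨h, by rw [hh]; push_cast; ring⟩
      rw [ha] at h1
      norm_num at h1
    have h2 : (h : ZMod q) + h = 0 := by
      rw [← Nat.cast_add, ← hh]
      exact ZMod.natCast_self q
    have h3 : (a : ZMod q) * (h : ZMod q) ^ 2 = h := by
      obtain ⟨k, hk⟩ := haodd.mul hodd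
      have hk' : (a : ZMod q) * h = 2 * k + 1 := by exact_mod_cast congrArg (Int.cast : ℤ → ZMod q) hk
      linear_combination (h : ZMod q) * hk' + k * h2
    have h5 : ZMod.stdAddChar (N := q) (h : ZMod q) = -1 := by
      have := e2pi_std q h
      rw [Int.cast_natCast, Int.cast_natCast] at this
      rw [← this, e2pi, ← Complex.exp_pi_mul_I]
      congr 1
      have : (q : ℂ) = 2 * h := by rw [hh]; push_cast; ring
      have h0 : (h : ℂ) ≠ 0 := by
        rw [Nat.cast_ne_zero]; omega
      rw [this]
      field_simp
    have key : Gsum a (m + m) q = - Gsum a (m + m) q := by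
      conv_lhs => rw [Gsum_zmod, ← Equiv.sum_comp (Equiv.addRight (h : ZMod q))]
      rw [Gsum_zmod, ← Finset.sum_neg_distrib]
      refine Finset.sum_congr rfl fun x _ => ?_
      rw [Equiv.coe_addRight, neg_eq_neg_one_mul, ← h5, ← AddChar.map_add_eq_mul]
      congr 1
      push_cast
      linear_combination h3 + (a * x + m) * h2
    exact self_eq_neg.1 key
  · intro _ abar hab
    have hab' : (abar : ZMod q) * a = 1 := by
      have := (ZMod.intCast_eq_intCast_iff _ _ q).2 hab
      exact_mod_cast this
    have hm : (m + m) / 2 = m := by omega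
    rw [hm, e2pi_std, Gsum_zmod, Gsum_zmod, Finset.mul_sum,
      ← Equiv.sum_comp (Equiv.addRight (-(abar * m : ZMod q)))]
    refine Finset.sum_congr rfl fun x _ => ?_
    rw [Equiv.coe_addRight, ← AddChar.map_add_eq_mul]
    congr 1
    push_cast
    linear_combination (abar * m ^ 2 - 2 * m * x) * hab'
end

section
/- Let q be an even positive integer and let n, l be even integers. If q ≡ 2 (mod 4), then K(n,l;q) = 0. If q ≡ 0 (mod 4), then K(n,l;q) = 2·i·q · Σ_{a,b mod q, ab ≡ 1 (mod q)} χ₄(a)·e(−(a·(l/2)² + b·(n/2)²)/q). -/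
open Complex Real MeasureTheory Filter Finset

lemma c_add (x y : ℂ) : e2pi (x + y) = e2pi x * e2pi y := by
  unfold e2pi; rw [← Complex.exp_add]; ring_nf

lemma c_int (k : ℤ) : e2pi (k : ℂ) = 1 := by
  unfold e2pi; rw [Complex.exp_eq_one_iff]; exact ⟨k, by ring⟩

noncomputable def EE (q : ℕ) (k : ℤ) : ℂ := e2pi ((k : ℂ) / (q : ℂ))

lemma EE_add (q : ℕ) (j k : ℤ) : EE q (j + k) = EE q j * EE q k := by
  unfold EE; rw [← c_add]; push_cast; rw [add_div]

lemma EE_mul (q : ℕ) (hq : 0 < q) (k : ℤ) : EE q (q * k) = 1 := by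
  unfold EE
  have : (q : ℂ) ≠ 0 := by exact_mod_cast hq.ne'
  rw [← c_int k]; congr 1; push_cast; field_simp

lemma EE_zero (q : ℕ) : EE q 0 = 1 := by
  unfold EE; simp [e2pi]

lemma EE_congr (q : ℕ) (hq : 0 < q) {j k : ℤ} (h : (q : ℤ) ∣ j - k) : EE q j = EE q k := by
  obtain ⟨c, hc⟩ := h
  have : j = k + q * c := by linarith
  rw [this, EE_add, EE_mul q hq, mul_one]

lemma EE_cancel (c q : ℕ) (hc : 0 < c) (k : ℤ) : EE (c * q) (c * k) = EE q k := by
  unfold EE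
  have : (c : ℂ) ≠ 0 := by exact_mod_cast hc.ne'
  push_cast
  rw [mul_div_mul_left _ _ this]

lemma EE_one_iff (q : ℕ) (hq : 0 < q) (k : ℤ) (h : EE q k = 1) : (q : ℤ) ∣ k := by
  unfold EE e2pi at h
  rw [Complex.exp_eq_one_iff] at h
  obtain ⟨m, hm⟩ := h
  have hq' : (q : ℂ) ≠ 0 := by exact_mod_cast hq.ne'
  have hpi := Complex.two_pi_I_ne_zero
  have h2 : (k : ℂ) / q = m := by
    apply mul_left_cancel₀ hpi; rw [hm]; ring
  rw [div_eq_iff hq'] at h2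
  exact ⟨m, by rw [mul_comm]; exact_mod_cast h2⟩

lemma EE_two (k : ℤ) (hk : k % 2 = 1) : EE 2 k = -1 := by
  rw [EE_congr 2 (by norm_num) (k := 1) (by push_cast; omega)]
  unfold EE e2pi
  rw [← Complex.exp_pi_mul_I]; congr 1; push_cast; ring

lemma EE_four_one : EE 4 1 = Complex.I := by
  unfold EE e2pi
  refine Eq.trans ?_ Complex.exp_pi_div_two_mul_I
  congr 1; push_cast; ring

lemma EE_four (k : ℤ) (hk : k % 2 = 1) : EE 4 k = Complex.I * chi4 k := by
  have h : k % 4 = 1 ∨ k % 4 = 3 := by omega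
  rcases h with h | h
  · rw [EE_congr 4 (by norm_num) (k := 1) (by push_cast; omega), EE_four_one]
    simp [chi4, h]
  · rw [EE_congr 4 (by norm_num) (k := 1 + 2 * 1) (by push_cast; omega), EE_add, EE_four_one]
    have := EE_cancel 2 2 (by norm_num) 1
    norm_num at this
    rw [show (2 * 1 : ℤ) = 2 by norm_num, this, EE_two _ (by norm_num)]
    simp [chi4, h]

lemma sum_affine (q : ℕ) (hq : 0 < q) (f : ℤ → ℂ) (hf : ∀ x y : ℤ, (q : ℤ) ∣ x - y → f x = f y)
    (c c' d : ℤ) (hc : (q : ℤ) ∣ c * c' - 1) :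
    ∑ x ∈ Finset.range q, f (c * (x : ℤ) + d) = ∑ x ∈ Finset.range q, f (x : ℤ) := by
  have hq' : (0 : ℤ) < q := by exact_mod_cast hq
  have key : ∀ z : ℤ, (((z % q).toNat : ℕ) : ℤ) = z % q := fun z =>
    Int.toNat_of_nonneg (Int.emod_nonneg _ hq'.ne')
  have lt : ∀ z : ℤ, (z % q).toNat ∈ Finset.range q := fun z => by
    have := Int.emod_lt_of_pos z hq'
    have := Int.emod_nonneg z hq'.ne'
    rw [Finset.mem_range]; omega
  have uniq : ∀ (z : ℤ) (x : ℕ), x ∈ Finset.range q → (q : ℤ) ∣ z - x → (z % q).toNat = x := by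
    intro z x hx h
    have hx' : (x : ℤ) < q := by exact_mod_cast Finset.mem_range.mp hx
    have : z % q = x := by
      rw [(Int.emod_emod_of_dvd z dvd_rfl).symm]
      rw [Int.emod_emod_of_dvd z dvd_rfl, Int.emod_eq_emod_iff_emod_sub_eq_zero.mpr
        (Int.emod_eq_zero_of_dvd h)]
      exact Int.emod_eq_of_lt (by positivity) hx'
    rw [this]; simp
  have dv : ∀ z : ℤ, (q : ℤ) ∣ z - z % q := fun z => Int.dvd_self_sub_emod
  refine Finset.sum_nbij' (fun x => ((c * (x : ℤ) + d) % q).toNat)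
    (fun y => ((c' * ((y : ℤ) - d)) % q).toNat) (fun x _ => lt _) (fun x _ => lt _) ?_ ?_ ?_
  · intro x hx
    apply uniq _ _ hx
    rw [key]
    obtain ⟨u, hu⟩ := dv (c * x + d)
    obtain ⟨v, hv⟩ := hc
    exact ⟨-(c' * u) + v * x, by linear_combination (-c') * hu + x * hv⟩
  · intro x hx
    apply uniq _ _ hx
    rw [key]
    obtain ⟨u, hu⟩ := dv (c' * (x - d))
    obtain ⟨v, hv⟩ := hc
    exact ⟨-(c * u) + v * (x - d), by linear_combination (-c) * hu + (x - d) * hv⟩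
  · intro x hx
    apply hf
    rw [key]; exact dv _

lemma sum_split (N r : ℕ) (f : ℤ → ℂ) :
    ∑ x ∈ Finset.range (N * r), f (x : ℤ) =
      ∑ y ∈ Finset.range N, ∑ z ∈ Finset.range r, f ((y : ℤ) + N * z) := by
  rw [Finset.sum_comm]
  induction r with
  | zero => simp
  | succ r ih =>
    rw [Nat.mul_succ, Finset.sum_range_add, ih, Finset.sum_range_succ]
    congr 1
    apply Finset.sum_congr rfl
    intro x _
    congr 1; push_cast; ring

lemma geom_zero (p : ℕ) (hp : 0 < p) (c : ℤ) (hc : ¬ (p : ℤ) ∣ c) :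
    ∑ z ∈ Finset.range p, EE p (c * z) = 0 := by
  have h := sum_affine p hp (fun z => EE p (c * z)) (fun x y h => EE_congr p hp (by
    rw [← mul_sub]; exact h.mul_left c)) 1 1 1 (by simp)
  simp only [mul_add, EE_add, one_mul, mul_one] at h
  rw [← Finset.sum_mul] at h
  by_contra h0
  exact hc (EE_one_iff p hp c (mul_left_cancel₀ h0 (by rw [h, mul_one])))

noncomputable def TT (a : ℤ) (q : ℕ) : ℂ := ∑ x ∈ Finset.range q, EE q (a * (x : ℤ) ^ 2)

lemma TT_odd_sq (a : ℤ) (p s : ℕ) (hp : 0 < p) (hs : 0 < s) (hpo : p.Prime) (hp2 : p ≠ 2)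
    (ha : ¬ (p : ℤ) ∣ a) :
    TT a (p * s * p) = p * TT a s := by
  have hq : 0 < p * s * p := by positivity
  unfold TT
  rw [sum_split (p * s) p (fun x => EE (p * s * p) (a * x ^ 2))]
  have h1 : ∀ y z : ℤ, EE (p * s * p) (a * (y + ((p * s : ℕ) : ℤ) * z) ^ 2)
      = EE (p * s * p) (a * y ^ 2) * EE p (2 * a * y * z) := by
    intro y z
    rw [← EE_cancel (p * s) p (by positivity), ← EE_add]
    apply EE_congr _ hq
    exact ⟨a * s * z ^ 2, by push_cast; ring⟩
  simp only [h1, ← Finset.mul_sum]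
  rw [sum_split p s (fun y => EE (p * s * p) (a * y ^ 2) * ∑ z ∈ Finset.range p, EE p (2 * a * y * z))]
  rw [Finset.sum_eq_single 0]
  · rw [Finset.mul_sum]
    apply Finset.sum_congr rfl
    intro w _
    have h2 : ∀ z ∈ Finset.range p, EE p (2 * a * (((0 : ℕ) : ℤ) + p * w) * z) = 1 := by
      intro z _
      rw [← EE_mul p hp (2 * a * w * z)]; congr 1; push_cast; ring
    rw [Finset.sum_congr rfl h2]
    have h3 : EE (p * s * p) (a * (((0 : ℕ) : ℤ) + p * w) ^ 2) = EE s (a * w ^ 2) := by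
      rw [← EE_cancel (p * p) s (by positivity)]
      congr 1
      · ring
      · push_cast; ring
    rw [h3]; simp [mul_comm]
  · intro j hj hj0
    apply Finset.sum_eq_zero
    intro w _
    rw [geom_zero p hp, mul_zero]
    intro hd
    have hpi : Prime (p : ℤ) := Nat.prime_iff_prime_int.mp hpo
    have hjp := Finset.mem_range.mp hj
    rcases hpi.dvd_or_dvd hd with h | h
    · rcases hpi.dvd_or_dvd h with h | h
      · have : p ∣ 2 := by exact_mod_cast h
        exact hp2 ((Nat.prime_dvd_prime_iff_eq hpo Nat.prime_two).mp this)
      · exact ha h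
    · have : (p : ℤ) ∣ j := by simpa using h
      have : p ∣ j := by exact_mod_cast this
      have := Nat.le_of_dvd (by omega) this
      omega
  · intro h; exact absurd (Finset.mem_range.mpr hp) h

lemma TT_sixteen (a : ℤ) (t : ℕ) (ht : 0 < t) (hte : 2 ∣ t) (ha : a % 2 = 1) :
    TT a (2 * t * 4) = 2 * TT a (t * 2) := by
  obtain ⟨v, rfl⟩ := hte
  have hq : 0 < 2 * (2 * v) * 4 := by positivity
  have e1 : TT a (2 * v * 2) = ∑ w ∈ Finset.range (2 * v), 2 * EE (2 * v * 2) (a * w ^ 2) := by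
    unfold TT
    rw [sum_split (2 * v) 2 (fun x => EE (2 * v * 2) (a * x ^ 2))]
    apply Finset.sum_congr rfl
    intro w _
    rw [Finset.sum_range_succ, Finset.sum_range_one, two_mul (EE _ _)]
    refine congrArg₂ _ ?_ ?_
    · simp
    · apply EE_congr _ (by positivity)
      exact ⟨a * (w + v), by push_cast; ring⟩
  rw [e1]
  unfold TT
  rw [sum_split (2 * (2 * v)) 4 (fun x => EE (2 * (2 * v) * 4) (a * x ^ 2))]
  have h1 : ∀ y z : ℤ, EE (2 * (2 * v) * 4) (a * (y + ((2 * (2 * v) : ℕ) : ℤ) * z) ^ 2)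
      = EE (2 * (2 * v) * 4) (a * y ^ 2) * EE 2 (a * y * z) := by
    intro y z
    rw [← EE_cancel (8 * v) 2 (by omega), show 8 * v * 2 = 2 * (2 * v) * 4 by ring, ← EE_add]
    apply EE_congr _ hq
    exact ⟨a * v * z ^ 2, by push_cast; ring⟩
  simp only [h1, ← Finset.mul_sum (s := Finset.range 4)]
  rw [sum_split 2 (2 * v) (fun y => EE (2 * (2 * v) * 4) (a * y ^ 2) * ∑ z ∈ Finset.range 4, EE 2 (a * y * z))]
  rw [Finset.sum_range_succ, Finset.sum_range_one]
  have h0 : ∀ k : ℤ, k % 2 = 0 → EE 2 k = 1 := by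
    intro k hk
    rw [EE_congr 2 (by norm_num) (k := 0) (by push_cast; omega), EE_zero]
  have z0 : ∑ w ∈ Finset.range (2 * v), EE (2 * (2 * v) * 4) (a * (((1 : ℕ) : ℤ) + ((2 : ℕ) : ℤ) * w) ^ 2) *
      ∑ z ∈ Finset.range 4, EE 2 (a * (((1 : ℕ) : ℤ) + ((2 : ℕ) : ℤ) * w) * z) = 0 := by
    apply Finset.sum_eq_zero
    intro w _
    have o : (a * (((1 : ℕ) : ℤ) + ((2 : ℕ) : ℤ) * w)) % 2 = 1 := by
      rw [Int.mul_emod, ha]; push_cast; omega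
    generalize (a * (((1 : ℕ) : ℤ) + ((2 : ℕ) : ℤ) * w)) = k at *
    simp only [Finset.sum_range_succ, Finset.sum_range_zero]
    push_cast
    rw [h0 (k * 0) (by omega), EE_two (k * 1) (by omega), h0 (k * 2) (by omega),
      EE_two (k * 3) (by omega)]
    ring
  rw [z0, add_zero, Finset.mul_sum (f := fun w : ℕ => 2 * EE (2 * v * 2) (a * w ^ 2))]
  apply Finset.sum_congr rfl
  intro w _
  have h2 : ∀ z ∈ Finset.range 4, EE 2 (a * (((0 : ℕ) : ℤ) + ((2 : ℕ) : ℤ) * w) * z) = 1 := by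
    intro z _
    rw [← EE_mul 2 (by norm_num) (a * w * z)]; congr 1; push_cast; ring
  rw [Finset.sum_congr rfl h2]
  have h3 : EE (2 * (2 * v) * 4) (a * (((0 : ℕ) : ℤ) + ((2 : ℕ) : ℤ) * w) ^ 2)
      = EE (2 * v * 2) (a * w ^ 2) := by
    rw [← EE_cancel 4 (2 * v * 2) (by positivity)]
    congr 1
    · ring
    · push_cast; ring
  rw [h3]; simp; ring

lemma TT_crt (a : ℤ) (m p : ℕ) (hm : 0 < m) (hp : 0 < p) (h : Nat.Coprime p m) :
    TT a (m * p) = TT (a * p) m * TT (a * m) p := by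
  unfold TT
  rw [sum_split m p (fun x => EE (m * p) (a * x ^ 2))]
  have hq : 0 < m * p := by positivity
  obtain ⟨c, hc⟩ : ∃ c : ℤ, (m : ℤ) ∣ p * c - 1 := by
    have := Int.gcd_eq_gcd_ab p m
    have h' : Int.gcd p m = 1 := by simpa using h
    rw [h'] at this
    exact ⟨Int.gcdA p m, -Int.gcdB p m, by push_cast at this; linear_combination -this⟩
  have hg : ∀ x y : ℤ, (m : ℤ) ∣ x - y → ∑ z ∈ Finset.range p, EE (m * p) (a * (x + m * z) ^ 2)
      = ∑ z ∈ Finset.range p, EE (m * p) (a * (y + m * z) ^ 2) := by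
    rintro x y ⟨u, hu⟩
    have := sum_affine p hp (fun z => EE (m * p) (a * (y + m * z) ^ 2)) (by
      rintro z w ⟨k, hk⟩
      apply EE_congr _ hq
      have : z = w + p * k := by linarith
      subst this
      exact ⟨a * k * (2 * y + 2 * m * w + m * p * k), by push_cast; ring⟩) 1 1 u (by simp)
    rw [← this]
    apply Finset.sum_congr rfl
    intro z _
    congr 3
    linear_combination hu
  rw [← sum_affine m hm (fun y => ∑ z ∈ Finset.range p, EE (m * p) (a * (y + m * z) ^ 2)) hg p c 0 hc]
  rw [Finset.sum_mul_sum]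
  apply Finset.sum_congr rfl
  intro y _
  apply Finset.sum_congr rfl
  intro z _
  rw [← EE_cancel p m hp, ← EE_cancel m p hm, mul_comm p m, ← EE_add]
  apply EE_congr _ hq
  exact ⟨2 * a * y * z, by push_cast; ring⟩

lemma TT_four (a : ℤ) (ha : a % 2 = 1) : TT a 4 ^ 2 = 2 * Complex.I * 4 * chi4 a := by
  unfold TT
  simp only [Finset.sum_range_succ, Finset.sum_range_zero]
  push_cast
  rw [EE_congr 4 (by norm_num) (j := a * 0) (k := 0) (by push_cast; omega),
    EE_congr 4 (by norm_num) (j := a * 1) (k := a) (by push_cast; omega),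
    EE_congr 4 (by norm_num) (j := a * 4) (k := 0) (by push_cast; omega),
    EE_congr 4 (by norm_num) (j := a * 9) (k := a) (by push_cast; omega), EE_zero,
    EE_four a ha]
  have h : a % 4 = 1 ∨ a % 4 = 3 := by omega
  have := Complex.I_sq
  rcases h with h | h <;> simp [chi4, h] <;> linear_combination 4 * this

lemma TT_eight (a : ℤ) (ha : a % 2 = 1) : TT a 8 ^ 2 = 2 * Complex.I * 8 * chi4 a := by
  have e4 : EE 8 (4 * a) = -1 := by
    rw [← EE_two a ha, ← EE_cancel 4 2 (by norm_num)]; norm_num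
  have e2 : EE 8 a ^ 2 = Complex.I * chi4 a := by
    rw [← EE_four a ha, ← EE_cancel 2 4 (by norm_num), sq, ← EE_add]; norm_num; congr 1; ring
  unfold TT
  simp only [Finset.sum_range_succ, Finset.sum_range_zero]
  push_cast
  rw [EE_congr 8 (by norm_num) (j := a * 0) (k := 0) (by push_cast; omega),
    EE_congr 8 (by norm_num) (j := a * 1) (k := a) (by push_cast; omega),
    EE_congr 8 (by norm_num) (j := a * 4) (k := 4 * a) (by push_cast; omega),
    EE_congr 8 (by norm_num) (j := a * 9) (k := a) (by push_cast; omega),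
    EE_congr 8 (by norm_num) (j := a * 16) (k := 0) (by push_cast; omega),
    EE_congr 8 (by norm_num) (j := a * 25) (k := a) (by push_cast; omega),
    EE_congr 8 (by norm_num) (j := a * 36) (k := 4 * a) (by push_cast; omega),
    EE_congr 8 (by norm_num) (j := a * 49) (k := a) (by push_cast; omega), EE_zero, e4]
  linear_combination 16 * e2

lemma chi4_eq (k : ℤ) : ((ZMod.χ₄ (k : ZMod 4) : ℤ) : ℂ) = chi4 k := by
  rw [ZMod.χ₄_int_eq_if_mod_four]
  unfold chi4
  have h : k % 4 = 0 ∨ k % 4 = 1 ∨ k % 4 = 2 ∨ k % 4 = 3 := by omega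
  rcases h with h | h | h | h
  · simp [h, show k % 2 = 0 by omega]
  · simp [h, show k % 2 = 1 by omega]
  · simp [h, show k % 2 = 0 by omega]
  · simp [h, show k % 2 = 1 by omega]

lemma chi4_mul (j k : ℤ) : chi4 (j * k) = chi4 j * chi4 k := by
  rw [← chi4_eq, ← chi4_eq, ← chi4_eq]; push_cast; rw [map_mul]; push_cast; rfl

lemma chi4_sq (k : ℤ) (hk : k % 2 = 1) : chi4 k * chi4 k = 1 := by
  have h : k % 4 = 1 ∨ k % 4 = 3 := by omega
  rcases h with h | h <;> simp [chi4, h]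

lemma TT_prime (a : ℤ) (p : ℕ) (hp : p.Prime) (hp2 : p ≠ 2) (ha : ¬ (p : ℤ) ∣ a) :
    TT a p ^ 2 = chi4 p * p := by
  have : Fact p.Prime := ⟨hp⟩
  have hchar : ringChar (ZMod p) ≠ 2 := by rwa [ZMod.ringChar_zmod_n]
  have ha' : (a : ZMod p) ≠ 0 := by rwa [Ne, ZMod.intCast_zmod_eq_zero_iff_dvd]
  let ψ : AddChar (ZMod p) ℂ := AddChar.mulShift (ZMod.stdAddChar (N := p)) (a : ZMod p)
  have hψ : ψ.IsPrimitive := by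
    have h1 := ZMod.isPrimitive_stdAddChar p
    intro b hb
    have := h1 (mul_ne_zero ha' hb)
    rwa [← AddChar.mulShift_mulShift] at this
  let χ : MulChar (ZMod p) ℂ := (quadraticChar (ZMod p)).ringHomComp (Int.castRingHom ℂ)
  have hχ1 : χ ≠ 1 := (MulChar.ringHomComp_ne_one_iff (RingHom.injective_int _)).mpr
    (quadraticChar_ne_one hchar)
  have hχ2 : χ.IsQuadratic := (quadraticChar_isQuadratic (ZMod p)).comp _
  have hg := gaussSum_sq hχ1 hχ2 hψ
  have hm1 : χ (-1) = chi4 p := by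
    change ((quadraticChar (ZMod p) (-1) : ℤ) : ℂ) = _
    rw [quadraticChar_neg_one hchar, ← chi4_eq, ZMod.card]; simp
  rw [hm1, ZMod.card] at hg
  rw [← hg]
  congr 1
  have t1 : TT a p = ∑ u : ZMod p, ψ (u ^ 2) := by
    unfold TT
    refine Finset.sum_nbij' (fun x => (x : ZMod p)) (fun u => u.val) (fun x _ => Finset.mem_univ _)
      (fun u _ => Finset.mem_range.mpr (ZMod.val_lt u))
      (fun x hx => ZMod.val_cast_of_lt (Finset.mem_range.mp hx))
      (fun u _ => ZMod.natCast_zmod_val u) ?_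
    intro x _
    have h1 := ZMod.stdAddChar_coe (N := p) (a * (x : ℤ) ^ 2)
    have h2 : ψ ((x : ZMod p) ^ 2) = ZMod.stdAddChar ((a * (x : ℤ) ^ 2 : ℤ) : ZMod p) := by
      rw [AddChar.mulShift_apply]; push_cast; rfl
    rw [h2, h1, EE, e2pi, mul_div_assoc]
  have t2 : ∑ u : ZMod p, ψ (u ^ 2) = ∑ v : ZMod p, (χ v + 1) * ψ v := by
    rw [← Finset.sum_fiberwise (s := Finset.univ) (g := fun u : ZMod p => u ^ 2)]
    apply Finset.sum_congr rfl
    intro v _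
    have h := quadraticChar_card_sqrts hchar v
    have h' : ((Finset.univ.filter (fun u : ZMod p => u ^ 2 = v)).card : ℂ) = χ v + 1 := by
      change _ = ((quadraticChar (ZMod p) v : ℤ) : ℂ) + 1
      rw [← Int.cast_one, ← Int.cast_add, ← h]
      simp
    rw [← h', ← nsmul_eq_mul, ← Finset.sum_const]
    apply Finset.sum_congr rfl
    intro u hu
    rw [(Finset.mem_filter.mp hu).2]
  rw [t1, t2]
  simp only [add_mul, one_mul, Finset.sum_add_distrib]
  rw [AddChar.sum_eq_zero_of_ne_one (ψ := ψ), add_zero]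
  · rfl
  · simpa using hψ one_ne_zero

lemma TT_main (q : ℕ) : 0 < q → 4 ∣ q → ∀ a : ℤ, IsCoprime a (q : ℤ) →
    TT a q ^ 2 = 2 * Complex.I * q * chi4 a := by
  induction q using Nat.strong_induction_on with
  | _ q ih =>
  intro hq h4 a hc
  have ndvd : ∀ p : ℕ, p.Prime → p ∣ q → ¬ (p : ℤ) ∣ a := by
    intro p hp hpq hpa
    have := hc.isUnit_of_dvd' hpa (by exact_mod_cast hpq)
    exact (Nat.prime_iff_prime_int.mp hp).not_isUnit this
  have ha : a % 2 = 1 := by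
    have := ndvd 2 Nat.prime_two (by omega)
    push_cast at this; omega
  by_cases h16 : 16 ∣ q
  · obtain ⟨v, rfl⟩ := h16
    have e : 16 * v = 2 * (2 * v) * 4 := by ring
    have e' : 2 * v * 2 = 4 * v := by ring
    have i := ih (4 * v) (by omega) (by omega) (by omega) a
      (hc.of_isCoprime_of_dvd_right ⟨4, by push_cast; ring⟩)
    rw [e, TT_sixteen a (2 * v) (by omega) (by omega) ha, e', mul_pow, i]
    push_cast; ring
  by_cases h8 : q = 8
  · subst h8; simpa using TT_eight a ha
  by_cases h44 : q = 4
  · subst h44; simpa using TT_four a ha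
  obtain ⟨p, hp, hp2, hpq⟩ : ∃ p : ℕ, p.Prime ∧ p ≠ 2 ∧ p ∣ q := by
    obtain ⟨m, rfl⟩ := h4
    by_cases hm : 2 ∣ m
    · obtain ⟨k, rfl⟩ := hm
      obtain ⟨p, hp, hpk⟩ := Nat.exists_prime_and_dvd (n := k) (by omega)
      refine ⟨p, hp, ?_, (hpk.mul_left 2).mul_left 4⟩
      rintro rfl; omega
    · obtain ⟨p, hp, hpk⟩ := Nat.exists_prime_and_dvd (n := m) (by omega)
      refine ⟨p, hp, ?_, hpk.mul_left 4⟩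
      rintro rfl; omega
  have hpa := ndvd p hp hpq
  have hpo : p % 2 = 1 := by
    rcases hp.eq_two_or_odd with h | h
    · exact absurd h hp2
    · exact h
  have hcop4 : Nat.Coprime 4 p := by
    have : Nat.Coprime (2 ^ 2) p := Nat.Coprime.pow_left 2 ((Nat.coprime_primes Nat.prime_two hp).mpr (Ne.symm hp2))
    simpa using this
  obtain ⟨m, rfl⟩ := hpq
  have hm0 : 0 < m := Nat.pos_of_mul_pos_left hq
  have h4m : 4 ∣ m := hcop4.dvd_of_dvd_mul_left h4
  by_cases hpm : p ∣ m
  · obtain ⟨s, rfl⟩ := hpm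
    have hs0 : 0 < s := Nat.pos_of_mul_pos_left hm0
    have h4s : 4 ∣ s := hcop4.dvd_of_dvd_mul_left h4m
    have hlt : s < p * (p * s) := by
      have := hp.two_le
      nlinarith [Nat.mul_le_mul this this]
    have i := ih s hlt hs0 h4s a (hc.of_isCoprime_of_dvd_right ⟨p * p, by push_cast; ring⟩)
    rw [show p * (p * s) = p * s * p by ring, TT_odd_sq a p s hp.pos hs0 hp hp2 hpa, mul_pow, i]
    push_cast; ring
  · have hcm : Nat.Coprime p m := (Nat.Prime.coprime_iff_not_dvd hp).mpr hpm
    have hlt : m < p * m := by have := hp.two_le; nlinarith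
    have hcz : IsCoprime (p : ℤ) (m : ℤ) := Nat.isCoprime_iff_coprime.mpr hcm
    have i := ih m hlt hm0 h4m (a * p)
      (IsCoprime.mul_left (hc.of_isCoprime_of_dvd_right ⟨p, by push_cast; ring⟩) hcz)
    have hpam : ¬ (p : ℤ) ∣ a * m := by
      intro hd
      rcases (Nat.prime_iff_prime_int.mp hp).dvd_or_dvd hd with h | h
      · exact hpa h
      · exact hpm (by exact_mod_cast h)
    rw [mul_comm p m, TT_crt a m p hm0 hp.pos hcm, mul_pow, i, TT_prime _ p hp hp2 hpam, chi4_mul]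
    have := chi4_sq p (by exact_mod_cast hpo)
    push_cast
    linear_combination (2 * Complex.I * m * chi4 a * p) * this

lemma Gsum_eq (a n : ℤ) (q : ℕ) : Gsum a n q = ∑ x ∈ Finset.range q, EE q (a * (x : ℤ) ^ 2 + n * x) := rfl

lemma Gsum_TT (a b m : ℤ) (q : ℕ) (hq : 0 < q) (hab : (q : ℤ) ∣ a * b - 1) :
    Gsum a (2 * m) q = EE q (-(b * m ^ 2)) * TT a q := by
  have h := sum_affine q hq (fun x => EE q (a * x ^ 2)) (by
    intro x y hxy
    apply EE_congr q hq
    rw [show a * x ^ 2 - a * y ^ 2 = (x - y) * (a * (x + y)) by ring]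
    exact hxy.mul_right _) 1 1 (b * m) (by simp)
  unfold TT
  rw [← h, Gsum_eq, Finset.mul_sum]
  apply Finset.sum_congr rfl
  intro x _
  rw [← EE_add]
  apply EE_congr q hq
  obtain ⟨c, hc⟩ := hab
  exact ⟨-(2 * x * m * c) - b * m ^ 2 * c, by linear_combination (-(2 * x * m) - b * m ^ 2) * hc⟩

lemma TT_inv (a b : ℤ) (q : ℕ) (hq : 0 < q) (hab : (q : ℤ) ∣ a * b - 1) : TT b q = TT a q := by
  have h := sum_affine q hq (fun x => EE q (b * x ^ 2)) (by
    intro x y hxy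
    apply EE_congr q hq
    rw [show b * x ^ 2 - b * y ^ 2 = (x - y) * (b * (x + y)) by ring]
    exact hxy.mul_right _) a b 0 hab
  unfold TT
  rw [← h]
  apply Finset.sum_congr rfl
  intro x _
  apply EE_congr q hq
  obtain ⟨c, hc⟩ := hab
  exact ⟨a * x ^ 2 * c, by linear_combination (a * x ^ 2) * hc⟩

lemma TT_two_mod (a : ℤ) (ha : a % 2 = 1) (q : ℕ) (hq : q % 4 = 2) : TT a q = 0 := by
  obtain ⟨m, rfl⟩ : ∃ m, q = 2 * m := ⟨q / 2, by omega⟩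
  have hm : 0 < m := by omega
  have hq0 : 0 < 2 * m := by omega
  have h := sum_affine (2 * m) hq0 (fun x => EE (2 * m) (a * x ^ 2)) (by
    intro x y hxy
    apply EE_congr _ hq0
    rw [show a * x ^ 2 - a * y ^ 2 = (x - y) * (a * (x + y)) by ring]
    exact hxy.mul_right _) 1 1 m (by simp)
  have h2 : ∀ x ∈ Finset.range (2 * m), EE (2 * m) (a * (1 * (x : ℤ) + m) ^ 2)
      = EE (2 * m) (a * (x : ℤ) ^ 2) * (-1) := by
    intro x _
    have ham : (a * m) % 2 = 1 := by rw [Int.mul_emod, ha]; omega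
    rw [← EE_two (a * m) ham, ← EE_cancel m 2 hm, mul_comm m 2, ← EE_add]
    apply EE_congr _ hq0
    exact ⟨a * x, by push_cast; ring⟩
  rw [Finset.sum_congr rfl h2, ← Finset.sum_mul] at h
  unfold TT
  linear_combination (-1/2) * h

/-- `K(n,l;q)` for `q`, `n`, `l` even. -/
theorem Ksum_all_even (q : ℕ) (hq : 0 < q) (hqe : Even q) (n l : ℤ)
    (hn : Even n) (hl : Even l) :
    (q % 4 = 2 → Ksum n l q = 0) ∧
    (q % 4 = 0 → Ksum n l q = 2 * Complex.I * (q : ℂ) *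
      ∑ a ∈ Finset.range q, ∑ b ∈ Finset.range q,
        if (a * b) % q = 1 % q then
          chi4 a * e2pi (((-((a : ℤ) * (l / 2) ^ 2 + (b : ℤ) * (n / 2) ^ 2) : ℤ) : ℂ) / (q : ℂ))
        else 0) := by
  obtain ⟨n', rfl⟩ := hn
  obtain ⟨l', rfl⟩ := hl
  obtain ⟨r, hr⟩ := hqe
  have en : (n' + n') / 2 = n' := by omega
  have el : (l' + l') / 2 = l' := by omega
  have dvd : ∀ a b : ℕ, (a * b) % q = 1 % q → (q : ℤ) ∣ (a : ℤ) * b - 1 := by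
    intro a b h
    have h' : 1 ≡ a * b [MOD q] := h.symm
    have := (Nat.modEq_iff_dvd.mp h')
    exact_mod_cast this
  have prod : ∀ a b : ℕ, (a * b) % q = 1 % q → Gsum a (n' + n') q * Gsum b (l' + l') q
      = EE q (-((a : ℤ) * l' ^ 2 + b * n' ^ 2)) * TT a q ^ 2 := by
    intro a b h
    have h1 := dvd a b h
    rw [← two_mul, ← two_mul, Gsum_TT a b n' q hq h1, Gsum_TT b a l' q hq (by rwa [mul_comm]),
      TT_inv a b q hq h1, neg_add, EE_add]
    ring
  have cop : ∀ a b : ℕ, (a * b) % q = 1 % q → IsCoprime (a : ℤ) (q : ℤ) := by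
    intro a b h
    obtain ⟨c, hc⟩ := dvd a b h
    exact ⟨b, -c, by linear_combination hc⟩
  refine ⟨fun h2 => ?_, fun h0 => ?_⟩
  · unfold Ksum
    refine Finset.sum_eq_zero fun a _ => Finset.sum_eq_zero fun b _ => ?_
    split_ifs with h
    · rw [prod a b h, TT_two_mod a _ q h2]
      · simp
      · have := (cop a b h).of_isCoprime_of_dvd_right (show (2 : ℤ) ∣ q from ⟨r, by rw [hr]; push_cast; ring⟩)
        obtain ⟨u, v, huv⟩ := this
        by_contra hodd
        obtain ⟨k, hk⟩ : ∃ k : ℤ, (a : ℤ) = 2 * k := ⟨a / 2, by omega⟩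
        rw [hk] at huv
        have : 2 * (u * k + v) = 1 := by linear_combination huv
        omega
    · rfl
  · unfold Ksum
    rw [Finset.mul_sum]
    refine Finset.sum_congr rfl fun a _ => ?_
    rw [Finset.mul_sum]
    refine Finset.sum_congr rfl fun b _ => ?_
    split_ifs with h
    · rw [prod a b h, TT_main q hq (Nat.dvd_of_mod_eq_zero h0) a (cop a b h), en, el]
      unfold EE
      ring
    · simp
end
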